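/- Let p ∈ (0,1) and let (G_t)_{t≥1} be the preferential attachment process with edge-steps with parameter p, and set c_p = 1 − p/2. Then there exist positive constants C and C′, depending only on p, such that for all t ≥ 2: P( there exists a vertex i of G_t with d_t(i) ≥ C · t^{c_p} · (log t) / i^{c_p} ) ≤ C′ · t^{−9}. -/

import Mathlib

open MeasureTheory Filter

attribute [local instance] Classical.propDecidable

/-- Degree of vertex `i` at time `t` computed from the endpoint process `ep`:
the edge added at step `s` contributes `1` for each of its endpoints equal to `i`
(so a loop at `i` contributes `2`). -/
noncomputable def degOf {Ω : Type} (ep : ℕ → Ω → ℕ × ℕ) (t i : ℕ) (ω : Ω) : ℕ :=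
  ∑ s ∈ Finset.Icc 1 t,
    ((if (ep s ω).1 = i then 1 else 0) + (if (ep s ω).2 = i then 1 else 0))

/-- The preferential attachment random graph process with edge-steps and parameter `p`.
`G_1` is a single vertex (labeled `1`) with a loop.  At each step `t + 1` (for `t ≥ 1`),
with probability `p` a vertex-step occurs: a new vertex `nv t + 1` is added together with an
edge to an old vertex `u`, chosen with probability `d_t(u) / (2t)`; with probability `1 - p`
an edge-step occurs: an edge `{u, w}` is added, where `u` and `w` are chosen independently,
each with probability proportional to its degree.  The field `ep t` records the (ordered pair
of) endpoints of the unique edge added at step `t`, `nv t` is the number of vertices of `G_t`,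
and `Z t` tells whether step `t` was a vertex-step.  The one-step conditional laws are
prescribed via conditional expectations with respect to a filtration `ℱ` to which the process
is adapted. -/
structure PAProcess (p : ℝ) where
  Ω : Type
  m0 : MeasurableSpace Ω
  μ : Measure Ω
  isProb : IsProbabilityMeasure μ
  ℱ : Filtration ℕ m0
  Z : ℕ → Ω → Bool
  nv : ℕ → Ω → ℕ
  ep : ℕ → Ω → ℕ × ℕ
  nv_one : ∀ ω, nv 1 ω = 1
  ep_one : ∀ ω, ep 1 ω = (1, 1)
  nv_succ : ∀ t, 1 ≤ t → ∀ ω, nv (t + 1) ω = nv t ω + (if Z (t + 1) ω then 1 else 0)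
  ep_vertexStep : ∀ t, 1 ≤ t → ∀ ω, Z (t + 1) ω = true →
    (ep (t + 1) ω).2 = nv t ω + 1 ∧ 1 ≤ (ep (t + 1) ω).1 ∧ (ep (t + 1) ω).1 ≤ nv t ω
  ep_edgeStep : ∀ t, 1 ≤ t → ∀ ω, Z (t + 1) ω = false →
    1 ≤ (ep (t + 1) ω).1 ∧ (ep (t + 1) ω).1 ≤ nv t ω ∧
    1 ≤ (ep (t + 1) ω).2 ∧ (ep (t + 1) ω).2 ≤ nv t ω
  Z_meas : ∀ t, Measurable[ℱ t] (Z t)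
  nv_meas : ∀ t, Measurable[ℱ t] (nv t)
  ep_meas : ∀ t, Measurable[ℱ t] (ep t)
  condLaw_Z : ∀ t, 1 ≤ t →
    μ[Set.indicator {ω | Z (t + 1) ω = true} (fun _ => (1 : ℝ)) | ℱ t] =ᵐ[μ] fun _ => p
  condLaw_vertex : ∀ t, 1 ≤ t → ∀ u,
    μ[Set.indicator {ω | Z (t + 1) ω = true ∧ ep (t + 1) ω = (u, nv t ω + 1)}
        (fun _ => (1 : ℝ)) | ℱ t]
      =ᵐ[μ] fun ω => p * (degOf ep t u ω : ℝ) / (2 * t)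
  condLaw_edge : ∀ t, 1 ≤ t → ∀ u w,
    μ[Set.indicator {ω | Z (t + 1) ω = false ∧ ep (t + 1) ω = (u, w)}
        (fun _ => (1 : ℝ)) | ℱ t]
      =ᵐ[μ] fun ω => (1 - p) * (degOf ep t u ω : ℝ) * (degOf ep t w ω : ℝ) / (2 * t) ^ 2

namespace PAProcess

variable {p : ℝ} (P : PAProcess p)

/-- degree `d_t(i)` of vertex `i` in `G_t` (`0` if `i` is not yet present). -/
noncomputable def deg (t i : ℕ) (ω : P.Ω) : ℕ := degOf P.ep t i ω

/-- `i` and `j` are joined by at least one edge in `G_t`. -/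
def Joined (t i j : ℕ) (ω : P.Ω) : Prop :=
  ∃ s ∈ Finset.Icc 1 t, P.ep s ω = (i, j) ∨ P.ep s ω = (j, i)

/-- number of triangles of `G_t`: sets of three distinct vertices pairwise joined by at
least one edge (counted without edge multiplicities). -/
noncomputable def triangles (t : ℕ) (ω : P.Ω) : ℕ :=
  ((Finset.Icc 1 t ×ˢ Finset.Icc 1 t ×ˢ Finset.Icc 1 t).filter
    (fun q => q.1 < q.2.1 ∧ q.2.1 < q.2.2 ∧ P.Joined t q.1 q.2.1 ω ∧
      P.Joined t q.1 q.2.2 ω ∧ P.Joined t q.2.1 q.2.2 ω)).card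

/-- number of cherries (paths of length 2) of `G_t`: unordered pairs of distinct edges of
`G_t` sharing a common endpoint.  The edges of `G_t` are indexed by their creation times
`1 ≤ s ≤ t`. -/
noncomputable def cherries (t : ℕ) (ω : P.Ω) : ℕ :=
  ((Finset.Icc 1 t ×ˢ Finset.Icc 1 t).filter
    (fun q => q.1 < q.2 ∧
      ((P.ep q.1 ω).1 = (P.ep q.2 ω).1 ∨ (P.ep q.1 ω).1 = (P.ep q.2 ω).2 ∨
       (P.ep q.1 ω).2 = (P.ep q.2 ω).1 ∨ (P.ep q.1 ω).2 = (P.ep q.2 ω).2))).card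

/-- global clustering coefficient of `G_t`. -/
noncomputable def clustering (t : ℕ) (ω : P.Ω) : ℝ :=
  3 * (P.triangles t ω : ℝ) / (P.cherries t ω : ℝ)

/-- clique number of `G_t`: the largest `k` such that `G_t` contains `k` distinct vertices
pairwise joined by at least one edge. -/
noncomputable def cliqueNum (t : ℕ) (ω : P.Ω) : ℕ :=
  sSup {k | ∃ S : Finset ℕ, S ⊆ Finset.Icc 1 (P.nv t ω) ∧ S.card = k ∧
    ∀ i ∈ S, ∀ j ∈ S, i ≠ j → P.Joined t i j ω}

/-- `Γ_t(j)`: the number of distinct vertices joined to `j` by at least one edge in `G_t`. -/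
noncomputable def nbrCount (t j : ℕ) (ω : P.Ω) : ℕ :=
  ((Finset.Icc 1 t).filter (fun i => P.Joined t i j ω)).card

/-- the time at which vertex `j` is added to the graph. -/
noncomputable def addTime (j : ℕ) (ω : P.Ω) : ℕ := sInf {t | P.nv t ω = j}

/-- at step `s` an edge joining `i` and `j` is added by an edge-step. -/
def EdgeStepEdge (s i j : ℕ) (ω : P.Ω) : Prop :=
  2 ≤ s ∧ P.Z s ω = false ∧ (P.ep s ω = (i, j) ∨ P.ep s ω = (j, i))

/-- at step `s` an edge joining `i` and `j` is added by a vertex-step. -/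
def VertexStepEdge (s i j : ℕ) (ω : P.Ω) : Prop :=
  2 ≤ s ∧ P.Z s ω = true ∧ (P.ep s ω = (i, j) ∨ P.ep s ω = (j, i))

/-- at step `s` vertex `j` is added by a vertex-step and its attaching edge connects it
to vertex `i`. -/
def AttachEdge (s i j : ℕ) (ω : P.Ω) : Prop :=
  2 ≤ s ∧ P.Z s ω = true ∧ P.ep s ω = (i, j) ∧ P.nv s ω = j

/-- `i` and `j` are joined in `G_t` by at least one edge created at an edge-step. -/
def EdgeJoined (t i j : ℕ) (ω : P.Ω) : Prop :=
  ∃ s ∈ Finset.Icc 1 t, P.EdgeStepEdge s i j ω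

/-- `i` and `j` are joined in `G_t` by at least one edge created at a vertex-step. -/
def VJoined (t i j : ℕ) (ω : P.Ω) : Prop :=
  ∃ s ∈ Finset.Icc 1 t, P.VertexStepEdge s i j ω

/-- `i` and `j` are joined in `G_t`, and exclusively by edges created at vertex-steps. -/
def OnlyVertexJoined (t i j : ℕ) (ω : P.Ω) : Prop :=
  P.Joined t i j ω ∧
    ∀ s ∈ Finset.Icc 1 t, (P.ep s ω = (i, j) ∨ P.ep s ω = (j, i)) → P.Z s ω = true

end PAProcess

namespace PAProcess

attribute [local instance] PAProcess.m0 PAProcess.isProb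

variable {p : ℝ} (P : PAProcess p)

theorem nv_le {s : ℕ} (hs : 1 ≤ s) (ω : P.Ω) : P.nv s ω ≤ s := by
  induction s, hs using Nat.le_induction with
  | base => exact (P.nv_one ω).le
  | succ s hs ih =>
    rw [P.nv_succ s hs ω]
    split_ifs <;> omega

theorem nv_le_nv_succ {s : ℕ} (hs : 1 ≤ s) (ω : P.Ω) : P.nv s ω ≤ P.nv (s + 1) ω := by
  rw [P.nv_succ s hs ω]
  exact Nat.le_add_right _ _

theorem ep_succ_le {s : ℕ} (hs : 1 ≤ s) (ω : P.Ω) :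
    (P.ep (s + 1) ω).1 ≤ P.nv s ω ∧ (P.ep (s + 1) ω).2 ≤ P.nv (s + 1) ω := by
  have h := P.nv_succ s hs ω
  cases hZ : P.Z (s + 1) ω with
  | false =>
    obtain ⟨-, h1, -, h2⟩ := P.ep_edgeStep s hs ω hZ
    exact ⟨h1, h2.trans (P.nv_le_nv_succ hs ω)⟩
  | true =>
    obtain ⟨h2, -, h1⟩ := P.ep_vertexStep s hs ω hZ
    simp only [hZ, if_true] at h
    exact ⟨h1, by omega⟩

theorem deg_succ (s i : ℕ) (ω : P.Ω) :
    P.deg (s + 1) i ω = P.deg s i ω +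
      ((if (P.ep (s + 1) ω).1 = i then 1 else 0) +
        (if (P.ep (s + 1) ω).2 = i then 1 else 0)) := by
  unfold deg degOf
  rw [Finset.sum_Icc_succ_top (by omega)]

theorem deg_succ_le (s i : ℕ) (ω : P.Ω) : P.deg (s + 1) i ω ≤ P.deg s i ω + 2 := by
  rw [deg_succ]
  split_ifs <;> omega

@[simp]
theorem deg_zero (i : ℕ) (ω : P.Ω) : P.deg 0 i ω = 0 := by
  simp [deg, degOf]

theorem deg_le (s i : ℕ) (ω : P.Ω) : P.deg s i ω ≤ 2 * s := by
  induction s with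
  | zero => simp
  | succ s ih => exact (P.deg_succ_le s i ω).trans (by omega)

theorem deg_eq_zero {s i : ℕ} (hs : 1 ≤ s) (ω : P.Ω) (hi : P.nv s ω < i) :
    P.deg s i ω = 0 := by
  induction s, hs using Nat.le_induction with
  | base =>
    rw [P.nv_one] at hi
    simp [deg, degOf, P.ep_one, hi.ne]
  | succ s hs ih =>
    have h1 := P.ep_succ_le hs ω
    have h2 := P.nv_le_nv_succ hs ω
    rw [deg_succ, ih (by omega), if_neg (by omega), if_neg (by omega)]

/-- Vertex `j + 1` cannot appear before time `j + 1`. -/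
theorem deg_add_le (j k : ℕ) (ω : P.Ω) : P.deg (j + k) (j + 1) ω ≤ 2 * k := by
  induction k with
  | zero =>
    rcases Nat.eq_zero_or_pos j with rfl | hj
    · simp
    · simp [P.deg_eq_zero hj ω (Nat.lt_succ_of_le (P.nv_le hj ω))]
  | succ k ih => exact (P.deg_succ_le (j + k) (j + 1) ω).trans (by omega)

theorem sum_deg {s : ℕ} (hs : 1 ≤ s) (ω : P.Ω) :
    ∑ u ∈ Finset.range (s + 1), P.deg s u ω = 2 * s := by
  have key : ∀ n, n ≤ s → ∑ u ∈ Finset.range (s + 1), P.deg n u ω = 2 * n := by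
    intro n
    induction n with
    | zero => simp
    | succ n ih =>
      intro hn
      have h : (P.ep (n + 1) ω).1 < s + 1 ∧ (P.ep (n + 1) ω).2 < s + 1 := by
        rcases Nat.eq_zero_or_pos n with rfl | hn0
        · simp only [zero_add, P.ep_one]; omega
        · have h1 := P.ep_succ_le hn0 ω
          have h2 := P.nv_le hn0 ω
          have h3 := P.nv_le (Nat.le_add_left 1 n) ω
          omega
      simp only [deg_succ, Finset.sum_add_distrib, ih (by omega), Finset.sum_ite_eq,
        Finset.mem_range, h.1, h.2, if_true]
      omega
  exact key s le_rfl

theorem measurable_deg (s i : ℕ) : Measurable[P.ℱ s] (P.deg s i) := by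
  unfold deg degOf
  refine Finset.measurable_fun_sum _ fun r hr => ?_
  have h : Measurable[P.ℱ s] (P.ep r) :=
    (P.ep_meas r).mono (P.ℱ.mono (Finset.mem_Icc.1 hr).2) le_rfl
  have hf : Measurable (fun x : ℕ × ℕ =>
      (if x.1 = i then 1 else 0) + (if x.2 = i then 1 else 0) : ℕ × ℕ → ℕ) :=
    measurable_of_countable _
  exact hf.comp h

/-- The degree of vertex `i` at time `s`, with the value `1` while `i` is not yet present. -/
noncomputable def startedDeg (s i : ℕ) (ω : P.Ω) : ℕ :=
  if P.nv s ω < i then 1 else P.deg s i ω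

theorem measurable_startedDeg (s i : ℕ) : Measurable[P.ℱ s] (P.startedDeg s i) := by
  have h : MeasurableSet[P.ℱ s] {ω | P.nv s ω < i} :=
    P.nv_meas s (measurableSet_Iio (a := i))
  exact Measurable.ite h measurable_const (P.measurable_deg s i)

theorem startedDeg_le (s i : ℕ) (ω : P.Ω) : P.startedDeg s i ω ≤ 2 * s + 1 := by
  have := P.deg_le s i ω
  unfold startedDeg
  split_ifs <;> omega

theorem deg_le_startedDeg {s : ℕ} (hs : 1 ≤ s) (i : ℕ) (ω : P.Ω) :
    P.deg s i ω ≤ P.startedDeg s i ω := by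
  unfold startedDeg
  split_ifs with h
  · simp [P.deg_eq_zero hs ω h]
  · rfl

theorem startedDeg_succ_of_lt {s i : ℕ} (hs : 1 ≤ s) (ω : P.Ω) (h : P.nv s ω < i) :
    P.startedDeg (s + 1) i ω = 1 := by
  unfold startedDeg
  split_ifs with h'
  · rfl
  · have h1 := P.nv_succ s hs ω
    have h2 := P.ep_succ_le hs ω
    cases hZ : P.Z (s + 1) ω with
    | false => simp [hZ] at h1; omega
    | true =>
      obtain ⟨h3, -, -⟩ := P.ep_vertexStep s hs ω hZ
      simp only [hZ, if_true] at h1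
      rw [deg_succ, P.deg_eq_zero hs ω h, if_neg (by omega), if_pos (by omega)]

end PAProcess

/-- `f` is integrable with conditional expectation `g` given `m`. -/
def HasCondExp {Ω : Type*} (m : MeasurableSpace Ω) {m0 : MeasurableSpace Ω} (μ : Measure Ω)
    (f g : Ω → ℝ) : Prop :=
  Integrable f μ ∧ μ[f | m] =ᵐ[μ] g

namespace HasCondExp

variable {Ω : Type*} {m m0 : MeasurableSpace Ω} {μ : Measure Ω} {f f' g g' : Ω → ℝ}

theorem add (h : HasCondExp m μ f g) (h' : HasCondExp m μ f' g') :
    HasCondExp m μ (fun ω => f ω + f' ω) (fun ω => g ω + g' ω) := by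
  refine ⟨h.1.add h'.1, ?_⟩
  filter_upwards [condExp_add h.1 h'.1 m, h.2, h'.2] with ω h1 h2 h3
  exact h1.trans (by rw [Pi.add_apply, h2, h3])

theorem const_mul (h : HasCondExp m μ f g) (c : ℝ) :
    HasCondExp m μ (fun ω => c * f ω) (fun ω => c * g ω) := by
  refine ⟨h.1.const_mul c, ?_⟩
  filter_upwards [condExp_smul (μ := μ) c f m, h.2] with ω h1 h2
  exact h1.trans (by rw [Pi.smul_apply, h2, smul_eq_mul])

theorem const [IsProbabilityMeasure μ] (hm : m ≤ m0) (c : ℝ) :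
    HasCondExp m μ (fun _ => c) (fun _ => c) :=
  ⟨integrable_const c, by rw [condExp_const hm c]⟩

theorem sum {ι : Type*} {F G : ι → Ω → ℝ} (S : Finset ι) [IsProbabilityMeasure μ] (hm : m ≤ m0)
    (h : ∀ u ∈ S, HasCondExp m μ (F u) (G u)) :
    HasCondExp m μ (fun ω => ∑ u ∈ S, F u ω) (fun ω => ∑ u ∈ S, G u ω) := by
  classical
  induction S using Finset.induction_on with
  | empty => simpa using const hm 0
  | insert a S ha ih =>
    simp only [Finset.sum_insert ha]
    exact (h a (Finset.mem_insert_self a S)).add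
      (ih fun u hu => h u (Finset.mem_insert_of_mem hu))

/-- Pull out a bounded `m`-measurable factor. -/
theorem mul_left (h : HasCondExp m μ f g) (hm : m ≤ m0) {F : Ω → ℝ}
    (hF : StronglyMeasurable[m] F) {B : ℝ} (hB : ∀ ω, |F ω| ≤ B) :
    HasCondExp m μ (fun ω => F ω * f ω) (fun ω => F ω * g ω) := by
  have hI : Integrable (F * f) μ :=
    h.1.bdd_mul (hF.mono hm).aestronglyMeasurable
      (Filter.Eventually.of_forall fun ω => by simpa using hB ω)
  refine ⟨hI, ?_⟩
  filter_upwards [condExp_mul_of_stronglyMeasurable_left hF hI h.1, h.2] with ω h1 h2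
  rw [← h2]
  exact h1

theorem integrable_right (h : HasCondExp m μ f g) : Integrable g μ :=
  integrable_condExp.congr h.2

theorem integral_eq [IsProbabilityMeasure μ] (h : HasCondExp m μ f g) (hm : m ≤ m0) :
    ∫ ω, f ω ∂μ = ∫ ω, g ω ∂μ := by
  rw [← integral_congr_ae h.2, integral_condExp hm]

end HasCondExp

/-- The one-step moment bound: the conditional expectation of `w ^ X`, where `X` is the degree
increment, compared with the next value `z` of the base. -/
theorem pow_mul_increment_le {p w z s : ℝ} (hp1 : p < 1) (hw : 1 ≤ w) (hs : 0 < s)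
    (hz : w * Real.exp ((1 - p / 2) * (w - 1) / s) ≤ z) (d : ℕ) :
    w ^ d * (1 + (w - 1) * ((2 - p) * (d / (2 * s))) +
      (w - 1) ^ 2 * ((1 - p) * (d / (2 * s)) ^ 2)) ≤ z ^ d := by
  set x := (w - 1) * (d / (2 * s)) with hx
  have hx0 : 0 ≤ x := mul_nonneg (by linarith) (by positivity)
  have h1 : 1 + (w - 1) * ((2 - p) * (d / (2 * s))) +
      (w - 1) ^ 2 * ((1 - p) * (d / (2 * s)) ^ 2) ≤ Real.exp ((2 - p) * x) := by
    have h := Real.quadratic_le_exp_of_nonneg (x := (2 - p) * x)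
      (mul_nonneg (by linarith) hx0)
    refine le_trans ?_ h
    have : 0 ≤ x ^ 2 * (1 + (1 - p) ^ 2) := by positivity
    rw [hx] at *
    nlinarith
  have h2 : Real.exp ((2 - p) * x) = Real.exp ((1 - p / 2) * (w - 1) / s) ^ d := by
    rw [← Real.exp_nat_mul, hx]
    congr 1
    field_simp
  calc _ ≤ w ^ d * Real.exp ((1 - p / 2) * (w - 1) / s) ^ d := by
        rw [← h2]; gcongr
    _ = (w * Real.exp ((1 - p / 2) * (w - 1) / s)) ^ d := (mul_pow _ _ _).symm
    _ ≤ z ^ d := by gcongr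

/-- With base `(1 - y)⁻¹` the moment bound closes up along `y ↦ y (1 + a)`. -/
theorem inv_mul_exp_le {a y y' : ℝ} (hy' : 0 ≤ y') (hy : y < 1) (ha : 0 ≤ a)
    (h : y' * (1 + a) ≤ y) :
    (1 - y')⁻¹ * Real.exp (a * ((1 - y')⁻¹ - 1)) ≤ (1 - y)⁻¹ := by
  have hay : 0 ≤ y' * a := mul_nonneg hy' ha
  have h1 : 0 < 1 - y' := by nlinarith
  have h2 : 0 < 1 - y := by linarith
  rw [← div_eq_inv_mul, div_le_iff₀ h1, ← div_eq_inv_mul, le_div_iff₀ h2]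
  have h3 : (1 - y) / (1 - y') ≤ Real.exp (-(a * ((1 - y')⁻¹ - 1))) := by
    refine le_trans ?_ (Real.add_one_le_exp _)
    rw [div_le_iff₀ h1]
    field_simp
    nlinarith
  rw [div_le_iff₀ h1] at h3
  calc _ ≤ Real.exp (a * ((1 - y')⁻¹ - 1)) *
        (Real.exp (-(a * ((1 - y')⁻¹ - 1))) * (1 - y')) := by gcongr
    _ = 1 - y' := by rw [← mul_assoc, ← Real.exp_add]; simp

theorem one_add_div_le_rpow {c s : ℝ} (hc0 : 0 ≤ c) (hc1 : c ≤ 1) (hs : 1 < s) :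
    1 + c / s ≤ (s / (s - 1)) ^ c := by
  have hs0 : 0 < s := by linarith
  have hs1 : 0 < s - 1 := by linarith
  have h := rpow_one_add_le_one_add_mul_self (s := -(1 / s)) (p := c)
    (by rw [neg_le_neg_iff, div_le_one hs0]; exact hs.le) hc0 hc1
  have h4 : 1 + -(1 / s) = (s / (s - 1))⁻¹ := by field_simp; ring
  rw [h4, Real.inv_rpow (by positivity)] at h
  have hpos : 0 < (s / (s - 1)) ^ c := by positivity
  have h5 : (0 : ℝ) ≤ 1 + c / s := by positivity
  rw [inv_le_iff_one_le_mul₀ hpos] at h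
  have h6 : (1 + c / s) * (1 + c * -(1 / s)) ≤ 1 := by
    have : (1 + c / s) * (1 + c * -(1 / s)) = 1 - (c / s) ^ 2 := by ring
    rw [this]; nlinarith [sq_nonneg (c / s)]
  nlinarith

namespace PAProcess

attribute [local instance] PAProcess.m0 PAProcess.isProb

variable {p : ℝ} (P : PAProcess p)

theorem integrable_pow_startedDeg (s i : ℕ) {w : ℝ} (hw : 1 ≤ w) :
    Integrable (fun ω => w ^ P.startedDeg s i ω) P.μ := by
  have hm : Measurable (fun ω => w ^ P.startedDeg s i ω) :=
    (measurable_from_top (f := fun n : ℕ => w ^ n)).comp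
      ((P.measurable_startedDeg s i).mono (P.ℱ.le s) le_rfl)
  refine Integrable.of_bound hm.aestronglyMeasurable (w ^ (2 * s + 1))
    (Filter.Eventually.of_forall fun ω => ?_)
  rw [Real.norm_of_nonneg (by positivity)]
  exact pow_le_pow_right₀ hw (P.startedDeg_le s i ω)

/-- Decomposition of `w ^ d_{s+1}(i)` along the possible steps at time `s + 1`. -/
theorem pow_deg_succ_eq {s i : ℕ} (hs : 1 ≤ s) (ω : P.Ω) (hi : i ≤ P.nv s ω) (w : ℝ) :
    w ^ P.deg (s + 1) i ω = w ^ P.deg s i ω *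
      (1 + (w - 1) *
        ({ω | P.Z (s + 1) ω = true ∧ P.ep (s + 1) ω = (i, P.nv s ω + 1)}.indicator
            (fun _ => (1 : ℝ)) ω +
          ∑ u ∈ Finset.range (s + 1),
            ({ω | P.Z (s + 1) ω = false ∧ P.ep (s + 1) ω = (i, u)}.indicator
              (fun _ => (1 : ℝ)) ω +
            {ω | P.Z (s + 1) ω = false ∧ P.ep (s + 1) ω = (u, i)}.indicator
              (fun _ => (1 : ℝ)) ω)) +
        (w - 1) ^ 2 *
          {ω | P.Z (s + 1) ω = false ∧ P.ep (s + 1) ω = (i, i)}.indicator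
            (fun _ => (1 : ℝ)) ω) := by
  rw [deg_succ, pow_add]
  congr 1
  have hn := P.nv_le hs ω
  simp only [Set.indicator_apply, Set.mem_ofPred_eq, Prod.ext_iff]
  rcases Bool.eq_false_or_eq_true (P.Z (s + 1) ω) with hZ | hZ
  · obtain ⟨h2, -, -⟩ := P.ep_vertexStep s hs ω hZ
    have h3 : P.nv s ω + 1 ≠ i := by omega
    by_cases h1 : (P.ep (s + 1) ω).1 = i <;> simp [hZ, h1, h2, h3]
  · obtain ⟨-, h1, -, h2⟩ := P.ep_edgeStep s hs ω hZ
    have h3 : (P.ep (s + 1) ω).1 < s + 1 := by omega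
    have h4 : (P.ep (s + 1) ω).2 < s + 1 := by omega
    rw [Finset.sum_add_distrib]
    by_cases e1 : (P.ep (s + 1) ω).1 = i <;> by_cases e2 : (P.ep (s + 1) ω).2 = i
    · have : i < s + 1 := by omega
      simp [hZ, e1, e2, this]; ring
    · simp [hZ, e1, e2, h4]
    · simp [hZ, e1, e2, h3]
    · simp [hZ, e1, e2]

theorem hasCondExp_vertex {s : ℕ} (hs : 1 ≤ s) (i : ℕ) :
    HasCondExp (P.ℱ s) P.μ
      ({ω | P.Z (s + 1) ω = true ∧ P.ep (s + 1) ω = (i, P.nv s ω + 1)}.indicator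
        (fun _ => (1 : ℝ)))
      (fun ω => p * (P.deg s i ω : ℝ) / (2 * s)) := by
  refine ⟨(integrable_const (1 : ℝ)).indicator ?_, P.condLaw_vertex s hs i⟩
  have hm (r : ℕ) := P.ℱ.le r
  have hZ : Measurable (P.Z (s + 1)) := (P.Z_meas _).mono (hm _) le_rfl
  have he : Measurable (P.ep (s + 1)) := (P.ep_meas _).mono (hm _) le_rfl
  have hn : Measurable (P.nv s) := (P.nv_meas _).mono (hm _) le_rfl
  exact (measurableSet_eq_fun hZ measurable_const).inter
    (measurableSet_eq_fun he (measurable_const.prodMk (hn.add_const 1)))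

theorem hasCondExp_edge {s : ℕ} (hs : 1 ≤ s) (u w : ℕ) :
    HasCondExp (P.ℱ s) P.μ
      ({ω | P.Z (s + 1) ω = false ∧ P.ep (s + 1) ω = (u, w)}.indicator (fun _ => (1 : ℝ)))
      (fun ω => (1 - p) * (P.deg s u ω : ℝ) * (P.deg s w ω : ℝ) / (2 * s) ^ 2) := by
  refine ⟨(integrable_const (1 : ℝ)).indicator ?_, P.condLaw_edge s hs u w⟩
  have hm (r : ℕ) := P.ℱ.le r
  have hZ : Measurable (P.Z (s + 1)) := (P.Z_meas _).mono (hm _) le_rfl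
  have he : Measurable (P.ep (s + 1)) := (P.ep_meas _).mono (hm _) le_rfl
  exact (measurableSet_eq_fun hZ measurable_const).inter
    (measurableSet_eq_fun he measurable_const)

theorem integral_pow_startedDeg_succ_le (hp1 : p < 1) {s i : ℕ} (hs : 1 ≤ s) {w z : ℝ}
    (hw : 1 ≤ w) (hwz : w ≤ z)
    (hz : w * Real.exp ((1 - p / 2) * (w - 1) / s) ≤ z) :
    ∫ ω, w ^ P.startedDeg (s + 1) i ω ∂P.μ ≤ ∫ ω, z ^ P.startedDeg s i ω ∂P.μ := by
  have hm := P.ℱ.le s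
  have hlt : MeasurableSet[P.ℱ s] {ω | P.nv s ω < i} :=
    P.nv_meas s (measurableSet_Iio (a := i))
  set G : P.Ω → ℝ := fun ω => if P.nv s ω < i then w else 0 with hG
  set F : P.Ω → ℝ := fun ω => if P.nv s ω < i then 0 else w ^ P.deg s i ω with hF
  have hGm : StronglyMeasurable[P.ℱ s] G :=
    (Measurable.ite hlt measurable_const measurable_const).stronglyMeasurable
  have hFm : StronglyMeasurable[P.ℱ s] F :=
    (Measurable.ite hlt measurable_const
      ((measurable_from_top (f := fun n : ℕ => w ^ n)).comp
        (P.measurable_deg s i))).stronglyMeasurable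
  have hGB : ∀ ω, |G ω| ≤ w := fun ω => by
    simp only [hG]
    split_ifs
    · rw [abs_of_nonneg (by linarith)]
    · simp; linarith
  have hFB : ∀ ω, |F ω| ≤ w ^ (2 * s) := fun ω => by
    simp only [hF]
    split_ifs
    · simp; positivity
    · rw [abs_of_nonneg (by positivity)]
      exact pow_le_pow_right₀ hw (P.deg_le s i ω)
  have hH := (((HasCondExp.const (μ := P.μ) hm 1).add
    (((P.hasCondExp_vertex hs i).add
      (HasCondExp.sum (Finset.range (s + 1)) hm fun u _ =>
        (P.hasCondExp_edge hs i u).add (P.hasCondExp_edge hs u i))).const_mul (w - 1))).add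
    ((P.hasCondExp_edge hs i i).const_mul ((w - 1) ^ 2))).mul_left hm hFm hFB
  have hK := ((HasCondExp.const (μ := P.μ) hm 1).mul_left hm hGm hGB).add hH
  refine (integral_congr_ae (Filter.Eventually.of_forall fun ω => ?_)).trans_le
    ((hK.integral_eq hm).trans_le (integral_mono hK.integrable_right
      (P.integrable_pow_startedDeg s i (hw.trans hwz)) fun ω => ?_))
  · by_cases h : P.nv s ω < i
    · simp [hG, hF, h, P.startedDeg_succ_of_lt hs ω h]
    · have h' : ¬ P.nv (s + 1) ω < i := by
        have := P.nv_le_nv_succ hs ω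
        omega
      simp only [hG, hF, h, if_false, startedDeg, h', P.pow_deg_succ_eq hs ω (not_lt.1 h) w]
      ring
  by_cases h : P.nv s ω < i
  · simpa [hG, hF, h, startedDeg] using hwz
  · have hs0 : (0 : ℝ) < s := by exact_mod_cast hs
    have hsum : ∑ u ∈ Finset.range (s + 1), (P.deg s u ω : ℝ) = 2 * s := by
      exact_mod_cast P.sum_deg hs ω
    have hsum' : ∑ u ∈ Finset.range (s + 1),
        ((1 - p) * (P.deg s i ω : ℝ) * (P.deg s u ω : ℝ) / (2 * s) ^ 2 +
          (1 - p) * (P.deg s u ω : ℝ) * (P.deg s i ω : ℝ) / (2 * s) ^ 2) =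
        2 * (1 - p) * (P.deg s i ω / (2 * s)) := by
      calc _ = ∑ u ∈ Finset.range (s + 1),
            (2 * (1 - p) * P.deg s i ω / (2 * s) ^ 2) * (P.deg s u ω : ℝ) :=
            Finset.sum_congr rfl fun u _ => by ring
        _ = _ := by rw [← Finset.mul_sum, hsum]; field_simp
    simp only [hG, hF, h, startedDeg, if_false, hsum']
    refine le_trans (le_of_eq ?_) (pow_mul_increment_le hp1 hw hs0 hz (P.deg s i ω))
    ring

/-- The exponential moment of the degree of vertex `i` along the decreasing parameters
`y_s = (i / (s - 1)) ^ (1 - p / 2) / 2`. -/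
theorem integral_inv_pow_startedDeg_le (hp0 : 0 < p) (hp1 : p < 1) {i : ℕ} (hi : 1 ≤ i)
    {s : ℕ} (hs : i + 1 ≤ s) :
    ∫ ω, (1 - ((i : ℝ) / ((s : ℝ) - 1)) ^ (1 - p / 2) / 2)⁻¹ ^ P.startedDeg s i ω ∂P.μ ≤ 16 := by
  have hi0 : (0 : ℝ) < i := by exact_mod_cast hi
  induction s, hs using Nat.le_induction with
  | base =>
    have h2 : (1 - ((i : ℝ) / (((i + 1 : ℕ) : ℝ) - 1)) ^ (1 - p / 2) / 2)⁻¹ = 2 := by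
      push_cast
      rw [add_sub_cancel_right, div_self hi0.ne', Real.one_rpow]
      norm_num
    rw [h2]
    calc ∫ ω, (2 : ℝ) ^ P.startedDeg (i + 1) i ω ∂P.μ ≤ ∫ ω, (16 : ℝ) ∂P.μ := by
          refine integral_mono (P.integrable_pow_startedDeg _ _ one_le_two)
            (integrable_const _) fun ω => ?_
          have h4 : P.startedDeg (i + 1) i ω ≤ 4 := by
            obtain ⟨j, rfl⟩ := Nat.exists_eq_add_of_le' hi
            have := P.deg_add_le j 2 ω
            unfold startedDeg
            split_ifs
            · omega
            · exact this
          calc (2 : ℝ) ^ P.startedDeg (i + 1) i ω ≤ 2 ^ 4 :=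
                pow_le_pow_right₀ one_le_two h4
            _ = 16 := by norm_num
      _ = 16 := by simp
  | succ s hs ih =>
    refine le_trans ?_ ih
    have hc0 : 0 < 1 - p / 2 := by linarith
    have hc1 : 1 - p / 2 ≤ 1 := by linarith
    have hsi : (i : ℝ) + 1 ≤ s := by exact_mod_cast hs
    have hs1 : (0 : ℝ) < (s : ℝ) - 1 := by linarith
    have hs0 : (0 : ℝ) < s := by linarith
    push_cast
    rw [add_sub_cancel_right]
    set c := 1 - p / 2 with hc
    set y := ((i : ℝ) / ((s : ℝ) - 1)) ^ c / 2 with hy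
    set y' := ((i : ℝ) / (s : ℝ)) ^ c / 2 with hy'
    have hy'0 : 0 ≤ y' := by positivity
    have hy1 : y ≤ 1 / 2 := by
      have : ((i : ℝ) / ((s : ℝ) - 1)) ^ c ≤ 1 :=
        Real.rpow_le_one (by positivity) ((div_le_one hs1).2 (by linarith)) hc0.le
      linarith
    have hstep : y' * (1 + c / s) ≤ y := by
      have h := one_add_div_le_rpow hc0.le hc1 (s := s) (by linarith)
      calc y' * (1 + c / s) ≤ y' * ((s : ℝ) / (s - 1)) ^ c := by gcongr
        _ = y := by
          rw [hy, hy', div_mul_eq_mul_div, ← Real.mul_rpow (by positivity) (by positivity)]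
          have : (i : ℝ) / s * (s / (s - 1)) = i / (s - 1) := by field_simp
          rw [this]
    have hyy : y' ≤ y := by
      have : 0 ≤ y' * (c / s) := by positivity
      linarith
    refine P.integral_pow_startedDeg_succ_le hp1 (by omega) ?_ ?_ ?_
    · exact (one_le_inv₀ (by linarith)).2 (by linarith)
    · exact inv_anti₀ (by linarith) (by linarith)
    · have h := inv_mul_exp_le hy'0 (by linarith : y < 1) (by positivity : 0 ≤ c / s) hstep
      convert h using 3
      ring

theorem measure_deg_ge_le (hp0 : 0 < p) (hp1 : p < 1) {i t : ℕ} (hi : 1 ≤ i) (hit : i ≤ t)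
    (ht : 2 ≤ t) :
    P.μ.real {ω | 20 * (t : ℝ) ^ (1 - p / 2) * Real.log t / (i : ℝ) ^ (1 - p / 2) ≤
        (P.deg t i ω : ℝ)} ≤ 16 * (t : ℝ) ^ (-(10 : ℝ)) := by
  have hi0 : (0 : ℝ) < i := by exact_mod_cast hi
  have ht0 : (0 : ℝ) < t := by positivity
  have ht2 : (2 : ℝ) ≤ t := by exact_mod_cast ht
  have hlog : 1 / 2 < Real.log t :=
    lt_of_lt_of_le (by linarith [Real.log_two_gt_d9]) (Real.log_le_log two_pos ht2)
  rcases hit.eq_or_lt with rfl | hlt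
  · have : {ω | 20 * (i : ℝ) ^ (1 - p / 2) * Real.log i / (i : ℝ) ^ (1 - p / 2) ≤
        (P.deg i i ω : ℝ)} = ∅ := by
      ext ω
      simp only [Set.mem_ofPred_eq, Set.mem_empty_iff_false, iff_false, not_le]
      have hd : P.deg i i ω ≤ 2 := by
        obtain ⟨j, rfl⟩ := Nat.exists_eq_add_of_le' hi
        exact P.deg_add_le j 1 ω
      have hd' : (P.deg i i ω : ℝ) ≤ 2 := by exact_mod_cast hd
      have hpos : (0 : ℝ) < (i : ℝ) ^ (1 - p / 2) := by positivity
      rw [mul_right_comm, mul_div_assoc, div_self hpos.ne']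
      linarith
    rw [this, measureReal_empty]
    positivity
  · have hc0 : 0 < 1 - p / 2 := by linarith
    have hti : (i : ℝ) + 1 ≤ t := by exact_mod_cast hlt
    have ht1 : (0 : ℝ) < (t : ℝ) - 1 := by linarith
    have hE := P.integral_inv_pow_startedDeg_le hp0 hp1 hi hlt
    set c := 1 - p / 2 with hc
    set y := ((i : ℝ) / ((t : ℝ) - 1)) ^ c / 2 with hy
    have hy0 : 0 < y := by positivity
    have hy1 : y ≤ 1 / 2 := by
      have : ((i : ℝ) / ((t : ℝ) - 1)) ^ c ≤ 1 :=
        Real.rpow_le_one (by positivity) ((div_le_one ht1).2 (by linarith)) hc0.le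
      linarith
    have hyt : (i : ℝ) ^ c / (t : ℝ) ^ c / 2 ≤ y := by
      rw [hy, ← Real.div_rpow hi0.le ht0.le]
      gcongr
      linarith
    have hz1 : 1 ≤ (1 - y)⁻¹ := (one_le_inv₀ (by linarith)).2 (by linarith)
    have hexp : Real.exp y ≤ (1 - y)⁻¹ := by
      rw [le_inv_comm₀ (Real.exp_pos _) (by linarith), ← Real.exp_neg]
      linarith [Real.add_one_le_exp (-y)]
    have hsub : {ω | 20 * (t : ℝ) ^ c * Real.log t / (i : ℝ) ^ c ≤ (P.deg t i ω : ℝ)} ⊆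
        {ω | (t : ℝ) ^ (10 : ℝ) ≤ (1 - y)⁻¹ ^ P.startedDeg t i ω} := by
      intro ω hω
      simp only [Set.mem_ofPred_eq] at hω ⊢
      have hD : (P.deg t i ω : ℝ) ≤ P.startedDeg t i ω := by
        exact_mod_cast P.deg_le_startedDeg (by omega) i ω
      calc (t : ℝ) ^ (10 : ℝ) = Real.exp (Real.log t * 10) := Real.rpow_def_of_pos ht0 _
        _ ≤ Real.exp (P.startedDeg t i ω * y) := by
          refine Real.exp_le_exp.2 ?_
          have hic : (0 : ℝ) < (i : ℝ) ^ c := by positivity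
          have htc : (0 : ℝ) < (t : ℝ) ^ c := by positivity
          calc Real.log t * 10 = (20 * (t : ℝ) ^ c * Real.log t / (i : ℝ) ^ c) *
                ((i : ℝ) ^ c / (t : ℝ) ^ c / 2) := by field_simp; norm_num
            _ ≤ P.startedDeg t i ω * y :=
              mul_le_mul (hω.trans hD) hyt (by positivity) (by positivity)
        _ = Real.exp y ^ P.startedDeg t i ω := Real.exp_nat_mul _ _
        _ ≤ (1 - y)⁻¹ ^ P.startedDeg t i ω := by gcongr
    have hM := mul_meas_ge_le_integral_of_nonneg (μ := P.μ)
      (f := fun ω => (1 - y)⁻¹ ^ P.startedDeg t i ω)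
      (Filter.Eventually.of_forall fun ω => by
        have : 0 ≤ (1 - y)⁻¹ := by linarith
        positivity)
      (P.integrable_pow_startedDeg t i hz1) ((t : ℝ) ^ (10 : ℝ))
    rw [Real.rpow_neg ht0.le, ← div_eq_mul_inv, le_div_iff₀' (by positivity)]
    calc _ ≤ (t : ℝ) ^ (10 : ℝ) *
          P.μ.real {ω | (t : ℝ) ^ (10 : ℝ) ≤ (1 - y)⁻¹ ^ P.startedDeg t i ω} := by
          gcongr
          exact measure_ne_top _ _
      _ ≤ 16 := hM.trans hE

end PAProcess

/-- For `p ∈ (0,1)` and `c_p = 1 - p/2` there are positive constants `C, C'` (depending only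
on `p`) such that for all `t ≥ 2`,
`P(∃ i ∈ G_t, d_t(i) ≥ C t^{c_p} (log t) / i^{c_p}) ≤ C' t^{-9}`. -/
theorem all_degrees_upper_bound (p : ℝ) (hp0 : 0 < p) (hp1 : p < 1)
    (P : PAProcess p) :
    ∃ C C' : ℝ, 0 < C ∧ 0 < C' ∧
      ∀ t : ℕ, 2 ≤ t →
        (P.μ {ω | ∃ i : ℕ, 1 ≤ i ∧ i ≤ P.nv t ω ∧
            C * (t : ℝ) ^ (1 - p / 2) * Real.log t / (i : ℝ) ^ (1 - p / 2) ≤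
              (P.deg t i ω : ℝ)}).toReal ≤
          C' * (t : ℝ) ^ (-(9 : ℝ)) := by
  have := P.isProb
  refine ⟨20, 16, by norm_num, by norm_num, fun t ht => ?_⟩
  have ht0 : (0 : ℝ) < t := by positivity
  calc _ ≤ P.μ.real (⋃ i ∈ Finset.Icc 1 t,
        {ω | 20 * (t : ℝ) ^ (1 - p / 2) * Real.log t / (i : ℝ) ^ (1 - p / 2) ≤
          (P.deg t i ω : ℝ)}) := by
        refine measureReal_mono (fun ω hω => ?_) (measure_ne_top _ _)
        obtain ⟨i, hi, hin, hd⟩ := hω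
        exact Set.mem_biUnion (Finset.mem_coe.2
          (Finset.mem_Icc.2 ⟨hi, hin.trans (P.nv_le (by omega) ω)⟩)) hd
    _ ≤ ∑ i ∈ Finset.Icc 1 t, 16 * (t : ℝ) ^ (-(10 : ℝ)) :=
        (measureReal_biUnion_finset_le _ _).trans (Finset.sum_le_sum fun i hi =>
          P.measure_deg_ge_le hp0 hp1 (Finset.mem_Icc.1 hi).1 (Finset.mem_Icc.1 hi).2 ht)
    _ = 16 * ((t : ℝ) ^ (1 : ℝ) * (t : ℝ) ^ (-(10 : ℝ))) := by
        simp [mul_left_comm]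
    _ = 16 * (t : ℝ) ^ (-(9 : ℝ)) := by
        rw [← Real.rpow_add ht0]
        norm_num
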